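/- Let ν ≥ 0 and let (u, θ) be a smooth solution of the regularized thermoelasticity system on [0,T] with θ ≥ 0 on [0,T] × [a,b]. Set E₀ = (1/2)‖u₁‖_{L²}² + (1/2)‖(u₀)_x‖_{L²}² + ∫_a^b θ₀(x) dx. Then for every t ∈ [0,T]: (1/2)‖u_t(t)‖_{L²}² ≤ E₀, (1/2)‖u_x(t)‖_{L²}² ≤ E₀, ∫_a^b θ(t,x) dx ≤ E₀, and ν ∫₀ᵗ ‖u_tx(s)‖_{L²}² ds ≤ E₀. -/

import Mathlib

open Set MeasureTheory

/-- Partial derivative in the first (time) variable. -/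
noncomputable def pt (w : ℝ → ℝ → ℝ) (t x : ℝ) : ℝ := deriv (fun s => w s x) t

/-- Partial derivative in the second (space) variable. -/
noncomputable def px (w : ℝ → ℝ → ℝ) (t x : ℝ) : ℝ := deriv (fun y => w t y) x

/-- Square of the L² norm on (a,b). -/
noncomputable def sqInt (a b : ℝ) (f : ℝ → ℝ) : ℝ := ∫ x in a..b, (f x) ^ 2

/-- The L² norm on (a,b). -/
noncomputable def L2norm (a b : ℝ) (f : ℝ → ℝ) : ℝ := Real.sqrt (sqInt a b f)

/-- A smooth solution of the regularized thermoelasticity system on [0,T] × [a,b]: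
`u_tt − u_xx − ν u_txx = −μ θ_x`, `θ_t − θ_xx + μ θ u_tx = 0`,
with Dirichlet boundary conditions for `u` and Neumann boundary conditions for `θ`. -/
def IsRegSolution (a b μ T ν : ℝ) (u θ : ℝ → ℝ → ℝ) : Prop :=
  ContDiff ℝ (⊤ : ℕ∞) (Function.uncurry u) ∧ ContDiff ℝ (⊤ : ℕ∞) (Function.uncurry θ) ∧
  (∀ t ∈ Set.Icc (0:ℝ) T, ∀ x ∈ Set.Icc a b,
      pt (pt u) t x - px (px u) t x - ν * px (px (pt u)) t x = -μ * px θ t x) ∧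
  (∀ t ∈ Set.Icc (0:ℝ) T, ∀ x ∈ Set.Icc a b,
      pt θ t x - px (px θ) t x + μ * θ t x * px (pt u) t x = 0) ∧
  (∀ t ∈ Set.Icc (0:ℝ) T, u t a = 0 ∧ u t b = 0) ∧
  (∀ t ∈ Set.Icc (0:ℝ) T, px θ t a = 0 ∧ px θ t b = 0)

/-- The time derivative of a differentiable function, as a directional derivative. -/
theorem hasDerivAt_time {w : ℝ → ℝ → ℝ} (hw : Differentiable ℝ (Function.uncurry w)) (t x : ℝ) :
    HasDerivAt (fun s => w s x) (fderiv ℝ (Function.uncurry w) (t, x) (1, 0)) t :=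
  (hw (t, x)).hasFDerivAt.comp_hasDerivAt (f := fun s : ℝ => (s, x)) t
    ((hasDerivAt_id t).prodMk (hasDerivAt_const t x))

/-- The space derivative of a differentiable function, as a directional derivative. -/
theorem hasDerivAt_space {w : ℝ → ℝ → ℝ} (hw : Differentiable ℝ (Function.uncurry w)) (t x : ℝ) :
    HasDerivAt (fun y => w t y) (fderiv ℝ (Function.uncurry w) (t, x) (0, 1)) x :=
  (hw (t, x)).hasFDerivAt.comp_hasDerivAt (f := fun y : ℝ => (t, y)) x
    ((hasDerivAt_const x t).prodMk (hasDerivAt_id x))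

theorem hasDerivAt_pt {w : ℝ → ℝ → ℝ} (hw : Differentiable ℝ (Function.uncurry w)) (t x : ℝ) :
    HasDerivAt (fun s => w s x) (pt w t x) t :=
  (hasDerivAt_time hw t x).differentiableAt.hasDerivAt

theorem hasDerivAt_px {w : ℝ → ℝ → ℝ} (hw : Differentiable ℝ (Function.uncurry w)) (t x : ℝ) :
    HasDerivAt (fun y => w t y) (px w t x) x :=
  (hasDerivAt_space hw t x).differentiableAt.hasDerivAt

theorem uncurry_pt {w : ℝ → ℝ → ℝ} (hw : Differentiable ℝ (Function.uncurry w)) :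
    Function.uncurry (pt w) = fun p => fderiv ℝ (Function.uncurry w) p (1, 0) :=
  funext fun p => (hasDerivAt_time hw p.1 p.2).deriv

theorem uncurry_px {w : ℝ → ℝ → ℝ} (hw : Differentiable ℝ (Function.uncurry w)) :
    Function.uncurry (px w) = fun p => fderiv ℝ (Function.uncurry w) p (0, 1) :=
  funext fun p => (hasDerivAt_space hw p.1 p.2).deriv

theorem contDiff_pt {w : ℝ → ℝ → ℝ} (hw : ContDiff ℝ (⊤ : ℕ∞) (Function.uncurry w)) :
    ContDiff ℝ (⊤ : ℕ∞) (Function.uncurry (pt w)) := by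
  rw [uncurry_pt (hw.differentiable (by simp))]
  exact (hw.fderiv_right (m := (⊤ : ℕ∞)) (by simp)).clm_apply contDiff_const

theorem contDiff_px {w : ℝ → ℝ → ℝ} (hw : ContDiff ℝ (⊤ : ℕ∞) (Function.uncurry w)) :
    ContDiff ℝ (⊤ : ℕ∞) (Function.uncurry (px w)) := by
  rw [uncurry_px (hw.differentiable (by simp))]
  exact (hw.fderiv_right (m := (⊤ : ℕ∞)) (by simp)).clm_apply contDiff_const

/-- Mixed partial derivatives of a smooth function commute. -/
theorem pt_px_eq_px_pt {w : ℝ → ℝ → ℝ} (hw : ContDiff ℝ (⊤ : ℕ∞) (Function.uncurry w))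
    (t x : ℝ) : pt (px w) t x = px (pt w) t x := by
  have hd : Differentiable ℝ (Function.uncurry w) := hw.differentiable (by simp)
  have hf : DifferentiableAt ℝ (fderiv ℝ (Function.uncurry w)) (t, x) :=
    (hw.fderiv_right (m := (⊤ : ℕ∞)) (by simp)).differentiable (by simp) _
  have hsymm : IsSymmSndFDerivAt ℝ (Function.uncurry w) (t, x) :=
    hw.contDiffAt.isSymmSndFDerivAt
      (by rw [minSmoothness_of_isRCLikeNormedField]; exact WithTop.coe_le_coe.2 (le_top : (2 : ℕ∞) ≤ ⊤))
  have hdir (v : ℝ × ℝ) : fderiv ℝ (fun p => fderiv ℝ (Function.uncurry w) p v) (t, x) =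
      (fderiv ℝ (fderiv ℝ (Function.uncurry w)) (t, x)).flip v := by
    rw [fderiv_clm_apply hf (by fun_prop)]
    simp
  have hl := (hasDerivAt_time ((contDiff_px hw).differentiable (by simp)) t x).deriv
  have hr := (hasDerivAt_space ((contDiff_pt hw).differentiable (by simp)) t x).deriv
  rw [uncurry_px hd, hdir] at hl
  rw [uncurry_pt hd, hdir] at hr
  exact hl.trans ((hsymm (1, 0) (0, 1)).trans hr.symm)

/-- Differentiation under the integral sign for a smooth integrand. -/
theorem hasDerivAt_integral_pt {w : ℝ → ℝ → ℝ} (hw : ContDiff ℝ (⊤ : ℕ∞) (Function.uncurry w))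
    (a b t : ℝ) :
    HasDerivAt (fun s => ∫ x in a..b, w s x) (∫ x in a..b, pt w t x) t := by
  have hc : Continuous (Function.uncurry w) := hw.continuous
  have hc' : Continuous (Function.uncurry (pt w)) := (contDiff_pt hw).continuous
  obtain ⟨C, hC⟩ := ((isCompact_Icc (a := t - 1) (b := t + 1)).prod
    (isCompact_uIcc (a := a) (b := b))).exists_bound_of_continuousOn hc'.continuousOn
  refine (intervalIntegral.hasDerivAt_integral_of_dominated_loc_of_deriv_le
    (F' := pt w) (bound := fun _ => C) (Icc_mem_nhds (sub_one_lt t) (lt_add_one t))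
    (.of_forall fun s => ?_) ?_ ?_ (.of_forall fun x hx s hs => ?_) (by simp)
    (.of_forall fun x _ s _ => hasDerivAt_pt (hw.differentiable (by simp)) s x)).2
  · exact (hc.comp (by fun_prop : Continuous fun x : ℝ => (s, x))).aestronglyMeasurable
  · exact (hc.comp (by fun_prop : Continuous fun x : ℝ => (t, x))).intervalIntegrable _ _
  · exact (hc'.comp (by fun_prop : Continuous fun x : ℝ => (t, x))).aestronglyMeasurable
  · exact hC (s, x) ⟨hs, uIoc_subset_uIcc hx⟩

/-- A function vanishing along `x = c` for times in `[0,T]` has vanishing time derivative there. -/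
theorem pt_eq_zero_of_eq_zero {w : ℝ → ℝ → ℝ} (hw : Differentiable ℝ (Function.uncurry w))
    {T c : ℝ} (hT : 0 < T) (h : ∀ t ∈ Icc (0:ℝ) T, w t c = 0) {t : ℝ} (ht : t ∈ Icc (0:ℝ) T) :
    pt w t c = 0 :=
  UniqueDiffWithinAt.eq_deriv _ (uniqueDiffOn_Icc hT t ht) (hasDerivAt_pt hw t c).hasDerivWithinAt
    ((hasDerivWithinAt_const t _ (0 : ℝ)).congr h (h t ht))

theorem sqInt_nonneg {a b : ℝ} (hab : a ≤ b) (f : ℝ → ℝ) : 0 ≤ sqInt a b f :=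
  intervalIntegral.integral_nonneg hab fun _ _ => sq_nonneg _

/-- The energy density `u_t²/2 + u_x²/2 + θ`. -/
noncomputable def energyDensity (u θ : ℝ → ℝ → ℝ) (t x : ℝ) : ℝ :=
  (1/2) * pt u t x ^ 2 + (1/2) * px u t x ^ 2 + θ t x

theorem contDiff_energyDensity {u θ : ℝ → ℝ → ℝ}
    (hu : ContDiff ℝ (⊤ : ℕ∞) (Function.uncurry u))
    (hθ : ContDiff ℝ (⊤ : ℕ∞) (Function.uncurry θ)) :
    ContDiff ℝ (⊤ : ℕ∞) (Function.uncurry (energyDensity u θ)) :=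
  ((contDiff_const.mul ((contDiff_pt hu).pow 2)).add
    (contDiff_const.mul ((contDiff_px hu).pow 2))).add hθ

theorem integral_energyDensity {u θ : ℝ → ℝ → ℝ}
    (hu : ContDiff ℝ (⊤ : ℕ∞) (Function.uncurry u))
    (hθ : ContDiff ℝ (⊤ : ℕ∞) (Function.uncurry θ)) (a b t : ℝ) :
    ∫ x in a..b, energyDensity u θ t x =
      (1/2) * sqInt a b (fun x => pt u t x) + (1/2) * sqInt a b (fun x => px u t x)
        + ∫ x in a..b, θ t x := by
  have hslice : Continuous fun x : ℝ => (t, x) := by fun_prop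
  have h₁ : Continuous fun x => pt u t x := (contDiff_pt hu).continuous.comp hslice
  have h₂ : Continuous fun x => px u t x := (contDiff_px hu).continuous.comp hslice
  have h₃ : Continuous fun x => θ t x := hθ.continuous.comp hslice
  have i₁ : IntervalIntegrable (fun x => (1/2) * pt u t x ^ 2) volume a b :=
    (by fun_prop : Continuous _).intervalIntegrable _ _
  have i₂ : IntervalIntegrable (fun x => (1/2) * px u t x ^ 2) volume a b :=
    (by fun_prop : Continuous _).intervalIntegrable _ _
  simp only [energyDensity, sqInt]
  rw [intervalIntegral.integral_add (i₁.add i₂) (h₃.intervalIntegrable _ _),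
    intervalIntegral.integral_add i₁ i₂, intervalIntegral.integral_const_mul,
    intervalIntegral.integral_const_mul]

/-- The energy dissipation rate of a smooth solution is `ν ‖u_tx‖²`. -/
theorem integral_pt_energyDensity {a b μ T ν : ℝ} (hab : a ≤ b) (hT : 0 < T) {u θ : ℝ → ℝ → ℝ}
    (hsol : IsRegSolution a b μ T ν u θ) {t : ℝ} (ht : t ∈ Icc (0:ℝ) T) :
    ∫ x in a..b, pt (energyDensity u θ) t x = -(ν * sqInt a b (fun x => px (pt u) t x)) := by
  obtain ⟨hu, hθ, hmom, hheat, hDir, hNeu⟩ := hsol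
  have diff {w : ℝ → ℝ → ℝ} (hw : ContDiff ℝ (⊤ : ℕ∞) (Function.uncurry w)) :
      Differentiable ℝ (Function.uncurry w) := hw.differentiable (by simp)
  have hslice : Continuous fun x : ℝ => (t, x) := by fun_prop
  have hdens (x : ℝ) : pt (energyDensity u θ) t x =
      pt u t x * pt (pt u) t x + px u t x * px (pt u) t x + pt θ t x := by
    have h := ((((hasDerivAt_pt (diff (contDiff_pt hu)) t x).pow 2).const_mul (1/2)).add
      (((hasDerivAt_pt (diff (contDiff_px hu)) t x).pow 2).const_mul (1/2))).add
      (hasDerivAt_pt (diff hθ) t x)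
    refine h.deriv.trans ?_
    rw [pt_px_eq_px_pt hu]
    ring
  have hflux (x : ℝ) : HasDerivAt
      (fun y => pt u t y * (px u t y + ν * px (pt u) t y - μ * θ t y) + px θ t y)
      (px (pt u) t x * (px u t x + ν * px (pt u) t x - μ * θ t x)
        + pt u t x * (px (px u) t x + ν * px (px (pt u)) t x - μ * px θ t x)
        + px (px θ) t x) x :=
    ((hasDerivAt_px (diff (contDiff_pt hu)) t x).mul
      (((hasDerivAt_px (diff (contDiff_px hu)) t x).add
        ((hasDerivAt_px (diff (contDiff_px (contDiff_pt hu))) t x).const_mul ν)).sub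
        ((hasDerivAt_px (diff hθ) t x).const_mul μ))).add
      (hasDerivAt_px (diff (contDiff_px hθ)) t x)
  have hcE : Continuous fun x => pt (energyDensity u θ) t x :=
    (contDiff_pt (contDiff_energyDensity hu hθ)).continuous.comp hslice
  have hcD : Continuous fun x => px (pt u) t x :=
    (contDiff_px (contDiff_pt hu)).continuous.comp hslice
  have hcS : Continuous fun x => ν * px (pt u) t x ^ 2 := by fun_prop
  have hderiv : ∀ x ∈ uIcc a b, HasDerivAt
      (fun y => pt u t y * (px u t y + ν * px (pt u) t y - μ * θ t y) + px θ t y)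
      (pt (energyDensity u θ) t x + ν * px (pt u) t x ^ 2) x := by
    intro x hx
    rw [uIcc_of_le hab] at hx
    convert hflux x using 1
    rw [hdens]
    linear_combination pt u t x * hmom t ht x hx + hheat t ht x hx
  have hint := intervalIntegral.integral_eq_sub_of_hasDerivAt hderiv
    ((hcE.add hcS).intervalIntegrable _ _)
  rw [intervalIntegral.integral_add (hcE.intervalIntegrable _ _) (hcS.intervalIntegrable _ _),
    intervalIntegral.integral_const_mul,
    pt_eq_zero_of_eq_zero (diff hu) hT (fun s hs => (hDir s hs).1) ht,
    pt_eq_zero_of_eq_zero (diff hu) hT (fun s hs => (hDir s hs).2) ht,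
    (hNeu t ht).1, (hNeu t ht).2] at hint
  simp only [sqInt]
  linarith

/-- The energy identity. -/
theorem energy_identity {a b μ T ν : ℝ} (hab : a ≤ b) (hT : 0 < T) {u θ : ℝ → ℝ → ℝ}
    (hsol : IsRegSolution a b μ T ν u θ) {t : ℝ} (ht : t ∈ Icc (0:ℝ) T) :
    (∫ x in a..b, energyDensity u θ t x)
        + ν * (∫ s in (0:ℝ)..t, sqInt a b (fun x => px (pt u) s x))
      = ∫ x in a..b, energyDensity u θ 0 x := by
  have hu := hsol.1
  have hE := contDiff_energyDensity hsol.1 hsol.2.1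
  have hcont : Continuous fun s => sqInt a b (fun x => px (pt u) s x) :=
    intervalIntegral.continuous_parametric_intervalIntegral_of_continuous'
      (f := fun s x => px (pt u) s x ^ 2)
      ((continuous_pow 2).comp (contDiff_px (contDiff_pt hu)).continuous) a b
  have hder (s : ℝ) := (hasDerivAt_integral_pt hE a b s).add
    ((hcont.integral_hasStrictDerivAt 0 s).hasDerivAt.const_mul ν)
  have hconst := constant_of_has_deriv_right_zero (a := 0) (b := T)
    (fun s _ => (hder s).continuousAt.continuousWithinAt)
    (fun s hs => by
      have h := hder s
      rw [integral_pt_energyDensity hab hT hsol (Ico_subset_Icc_self hs), neg_add_cancel] at h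
      exact h.hasDerivWithinAt) t ht
  simpa using hconst

/-- **Time-independent first-order estimates.** If `(u,θ)` solves the regularized
thermoelasticity system with `θ ≥ 0`, and
`E₀ = (1/2)‖u₁‖² + (1/2)‖(u₀)_x‖² + ∫ θ₀`, then for every `t ∈ [0,T]`:
`(1/2)‖u_t(t)‖² ≤ E₀`, `(1/2)‖u_x(t)‖² ≤ E₀`, `∫ θ(t) ≤ E₀` and `ν ∫₀ᵗ ‖u_tx‖² ≤ E₀`. -/
theorem first_order_estimates (a b μ T ν : ℝ) (hab : a < b) (hμ : 0 < μ) (hT : 0 < T)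
    (hν : 0 ≤ ν) (u θ : ℝ → ℝ → ℝ) (hsol : IsRegSolution a b μ T ν u θ)
    (hpos : ∀ t ∈ Icc (0:ℝ) T, ∀ x ∈ Icc a b, 0 ≤ θ t x)
    (E₀ : ℝ)
    (hE₀ : E₀ = (1/2) * sqInt a b (fun x => pt u 0 x) + (1/2) * sqInt a b (fun x => px u 0 x)
      + ∫ x in a..b, θ 0 x) :
    ∀ t ∈ Icc (0:ℝ) T,
      (1/2) * sqInt a b (fun x => pt u t x) ≤ E₀ ∧
      (1/2) * sqInt a b (fun x => px u t x) ≤ E₀ ∧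
      (∫ x in a..b, θ t x) ≤ E₀ ∧
      ν * (∫ s in (0:ℝ)..t, sqInt a b (fun x => px (pt u) s x)) ≤ E₀ := by
  intro t ht
  have hid := energy_identity hab.le hT hsol ht
  rw [integral_energyDensity hsol.1 hsol.2.1, integral_energyDensity hsol.1 hsol.2.1, ← hE₀] at hid
  have hkin := sqInt_nonneg hab.le (fun x => pt u t x)
  have hpot := sqInt_nonneg hab.le (fun x => px u t x)
  have hheat : 0 ≤ ∫ x in a..b, θ t x := intervalIntegral.integral_nonneg hab.le (hpos t ht)
  have hdiss : 0 ≤ ν * ∫ s in (0:ℝ)..t, sqInt a b (fun x => px (pt u) s x) :=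
    mul_nonneg hν (intervalIntegral.integral_nonneg ht.1 fun _ _ => sqInt_nonneg hab.le _)
  refine ⟨?_, ?_, ?_, ?_⟩ <;> linarith
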